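/- (Theorem 2.1, existence part.) Let Ψ : C([a,b],E) → C([a,b],E) be a locally contracting Volterra operator with constant q < 1. Then the equation y = Ψy has a unique global or maximally extended solution, and each local solution is a restriction of this solution. Precisely, exactly one of the following holds: (i) there exists a global solution y ∈ C([a,b],E) such that every local solution of y = Ψy is a restriction of y; or (ii) there exists ζ ∈ (0, b−a] and a maximally extended solution y_ζ : [a,a+ζ) → E such that every local solution of y = Ψy is a restriction of y_ζ. -/

import Mathlib

open Set Filter Topology

noncomputable section

variable {E : Type*} [NormedAddCommGroup E] [NormedSpace ℝ E] [CompleteSpace E]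

/-- The partial sup-norm `‖y‖_ξ = sup_{t ∈ [a, a+ξ]} ‖y t‖` on `C([a,b], E)`. -/
def partNorm (a b ξ : ℝ) (y : C(Set.Icc a b, E)) : ℝ :=
  sSup ((fun t : Set.Icc a b => ‖y t‖) '' {t : Set.Icc a b | (t : ℝ) ≤ a + ξ})

/-- `y₁` and `y₂` agree on `[a, a+ξ]`. -/
def eqUpTo (a b ξ : ℝ) (y₁ y₂ : C(Set.Icc a b, E)) : Prop :=
  ∀ t : Set.Icc a b, (t : ℝ) ≤ a + ξ → y₁ t = y₂ t

/-- A Volterra operator on `C([a,b], E)` (in the sense of Tikhonov). -/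
def IsVolterra (a b : ℝ) (Ψ : C(Set.Icc a b, E) → C(Set.Icc a b, E)) : Prop :=
  ∀ ξ ∈ Set.Ioo (0:ℝ) (b - a), ∀ y₁ y₂ : C(Set.Icc a b, E),
    eqUpTo a b ξ y₁ y₂ → eqUpTo a b ξ (Ψ y₁) (Ψ y₂)

/-- A locally contracting operator with contraction constant `q`. -/
def IsLocallyContracting (a b q : ℝ) (Ψ : C(Set.Icc a b, E) → C(Set.Icc a b, E)) : Prop :=
  ∀ r > (0:ℝ), ∃ δ > (0:ℝ), ∀ y₁ y₂ : C(Set.Icc a b, E),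
    partNorm a b (b - a) y₁ ≤ r → partNorm a b (b - a) y₂ ≤ r →
      (partNorm a b δ (Ψ y₁ - Ψ y₂) ≤ q * partNorm a b δ (y₁ - y₂)) ∧
      (∀ γ ∈ Set.Ioc (0:ℝ) (b - a - δ), eqUpTo a b γ y₁ y₂ →
        partNorm a b (γ + δ) (Ψ y₁ - Ψ y₂) ≤ q * partNorm a b (γ + δ) (y₁ - y₂))

/-- A local solution of `y = Ψ y` on `[a, a+γ]`: a function continuous on `[a, a+γ]`
admitting a continuous extension `y ∈ C([a,b], E)` with `(Ψ y) t = g t` on `[a, a+γ]`. -/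
def IsLocalSolution (a b γ : ℝ) (Ψ : C(Set.Icc a b, E) → C(Set.Icc a b, E))
    (g : ℝ → E) : Prop :=
  0 < γ ∧ γ ≤ b - a ∧ ContinuousOn g (Set.Icc a (a + γ)) ∧
  ∃ y : C(Set.Icc a b, E),
    (∀ t : Set.Icc a b, (t : ℝ) ≤ a + γ → y t = g t) ∧
    (∀ t : Set.Icc a b, (t : ℝ) ≤ a + γ → Ψ y t = g t)

/-- A maximally extended solution of `y = Ψ y` on `[a, a+ζ)`. -/
def IsMaxExtSolution (a b ζ : ℝ) (Ψ : C(Set.Icc a b, E) → C(Set.Icc a b, E))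
    (g : ℝ → E) : Prop :=
  0 < ζ ∧ ζ ≤ b - a ∧ (∀ γ ∈ Set.Ioo (0:ℝ) ζ, IsLocalSolution a b γ Ψ g) ∧
  Tendsto (fun γ => sSup ((fun t => ‖g t‖) '' Set.Icc a (a + γ))) (𝓝[<] ζ) atTop

section

variable {F : Type*} [NormedAddCommGroup F] {a b : ℝ}

/-- The function that agrees with `y` on `[a, a+s]` and is constant on `[a+s, b]`. -/
def freezeAt (hab : a ≤ b) (s : ℝ) (y : C(Set.Icc a b, F)) : C(Set.Icc a b, F) :=
  y.comp ⟨fun t => Set.projIcc a b hab (min (t : ℝ) (a + s)),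
    continuous_projIcc.comp (continuous_subtype_val.min continuous_const)⟩

theorem freezeAt_apply (hab : a ≤ b) (s : ℝ) (y : C(Set.Icc a b, F)) (t : Set.Icc a b) :
    freezeAt hab s y t = y (Set.projIcc a b hab (min (t : ℝ) (a + s))) := rfl

theorem coe_projIcc_min (hab : a ≤ b) {s : ℝ} (hs : 0 ≤ s) (t : Set.Icc a b) :
    (Set.projIcc a b hab (min (t : ℝ) (a + s)) : ℝ) = min (t : ℝ) (a + s) := by
  have h : min (t : ℝ) (a + s) ∈ Set.Icc a b :=
    ⟨le_min t.2.1 (by linarith), (min_le_left _ _).trans t.2.2⟩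
  rw [Set.projIcc_of_mem hab h]

theorem freezeAt_of_le (hab : a ≤ b) {s : ℝ} (y : C(Set.Icc a b, F)) {t : Set.Icc a b}
    (ht : (t : ℝ) ≤ a + s) : freezeAt hab s y t = y t := by
  rw [freezeAt_apply, min_eq_left ht, Set.projIcc_val]

theorem norm_freezeAt_le_of_forall_le (hab : a ≤ b) {s M : ℝ} (hs : 0 ≤ s) (hM : 0 ≤ M)
    (y : C(Set.Icc a b, F)) (h : ∀ t : Set.Icc a b, (t : ℝ) ≤ a + s → ‖y t‖ ≤ M) :
    ‖freezeAt hab s y‖ ≤ M := by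
  rw [ContinuousMap.norm_le _ hM]
  intro t
  exact h _ ((coe_projIcc_min hab hs t).trans_le (min_le_right _ _))

theorem norm_freezeAt_le (hab : a ≤ b) {s : ℝ} (hs : 0 ≤ s) (y : C(Set.Icc a b, F)) :
    ‖freezeAt hab s y‖ ≤ ‖y‖ :=
  norm_freezeAt_le_of_forall_le hab hs (norm_nonneg _) y fun t _ => y.norm_coe_le_norm t

theorem freezeAt_freezeAt (hab : a ≤ b) {s γ : ℝ} (hγ : 0 ≤ γ) (hs : γ ≤ s)
    (y : C(Set.Icc a b, F)) : freezeAt hab s (freezeAt hab γ y) = freezeAt hab γ y := by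
  ext t
  rw [freezeAt_apply, freezeAt_apply, freezeAt_apply, coe_projIcc_min hab (hγ.trans hs), min_assoc,
    min_eq_right (by linarith : a + γ ≤ a + s)]

theorem norm_le_partNorm {ξ : ℝ} (y : C(Set.Icc a b, F)) {t : Set.Icc a b}
    (ht : (t : ℝ) ≤ a + ξ) : ‖y t‖ ≤ partNorm a b ξ y := by
  refine le_csSup ⟨‖y‖, ?_⟩ ⟨t, ht, rfl⟩
  rintro _ ⟨u, -, rfl⟩
  exact y.norm_coe_le_norm u

theorem partNorm_le {ξ M : ℝ} (hM : 0 ≤ M) (y : C(Set.Icc a b, F))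
    (h : ∀ t : Set.Icc a b, (t : ℝ) ≤ a + ξ → ‖y t‖ ≤ M) : partNorm a b ξ y ≤ M := by
  refine Real.sSup_le ?_ hM
  rintro _ ⟨u, hu, rfl⟩
  exact h u hu

theorem partNorm_le_norm (ξ : ℝ) (y : C(Set.Icc a b, F)) : partNorm a b ξ y ≤ ‖y‖ :=
  partNorm_le (norm_nonneg _) y fun t _ => y.norm_coe_le_norm t

theorem eqUpTo.symm {ξ : ℝ} {y₁ y₂ : C(Set.Icc a b, F)} (h : eqUpTo a b ξ y₁ y₂) :
    eqUpTo a b ξ y₂ y₁ := fun t ht => (h t ht).symm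

theorem eqUpTo.trans {ξ : ℝ} {y₁ y₂ y₃ : C(Set.Icc a b, F)} (h : eqUpTo a b ξ y₁ y₂)
    (h' : eqUpTo a b ξ y₂ y₃) : eqUpTo a b ξ y₁ y₃ := fun t ht => (h t ht).trans (h' t ht)

theorem eqUpTo.mono {ξ ξ' : ℝ} {y₁ y₂ : C(Set.Icc a b, F)} (h : eqUpTo a b ξ y₁ y₂)
    (hξ : ξ' ≤ ξ) : eqUpTo a b ξ' y₁ y₂ := fun t ht => h t (by linarith)

theorem eqUpTo_freezeAt (hab : a ≤ b) (s : ℝ) (y : C(Set.Icc a b, F)) :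
    eqUpTo a b s (freezeAt hab s y) y := fun _ ht => freezeAt_of_le hab y ht

theorem eqUpTo.freezeAt (hab : a ≤ b) {γ s : ℝ} (hs : 0 ≤ s) {y₁ y₂ : C(Set.Icc a b, F)}
    (h : eqUpTo a b γ y₁ y₂) : eqUpTo a b γ (freezeAt hab s y₁) (freezeAt hab s y₂) := by
  intro t ht
  exact h _ ((coe_projIcc_min hab hs t).trans_le ((min_le_left _ _).trans ht))

theorem eqUpTo.eq {ξ : ℝ} (hξ : b - a ≤ ξ) {y₁ y₂ : C(Set.Icc a b, F)}
    (h : eqUpTo a b ξ y₁ y₂) : y₁ = y₂ := by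
  ext t
  exact h t (by linarith [t.2.2])

theorem IsVolterra.eqUpTo_map {Ψ : C(Set.Icc a b, F) → C(Set.Icc a b, F)} (hΨ : IsVolterra a b Ψ)
    {ξ : ℝ} (hξ : 0 < ξ) {y₁ y₂ : C(Set.Icc a b, F)} (h : eqUpTo a b ξ y₁ y₂) :
    eqUpTo a b ξ (Ψ y₁) (Ψ y₂) := by
  rcases lt_or_ge ξ (b - a) with hlt | hge
  · exact hΨ ξ ⟨hξ, hlt⟩ y₁ y₂ h
  · rw [h.eq hge]
    exact fun _ _ => rfl

theorem IsVolterra.eqUpTo_freezeAt_self {Ψ : C(Set.Icc a b, F) → C(Set.Icc a b, F)}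
    (hΨ : IsVolterra a b Ψ) (hab : a ≤ b) {s : ℝ} (hs : 0 < s) {y : C(Set.Icc a b, F)}
    (h : eqUpTo a b s (Ψ y) y) : eqUpTo a b s (Ψ (freezeAt hab s y)) (freezeAt hab s y) :=
  ((hΨ.eqUpTo_map hs (eqUpTo_freezeAt hab s y)).trans h).trans (eqUpTo_freezeAt hab s y).symm

/-- `Ψ` contracts by the factor `q`, on the ball of radius `r`, along every step of length at
most `δ` beyond the interval on which two functions agree. -/
def ContractsOnSteps (a b q r δ : ℝ) (Ψ : C(Set.Icc a b, F) → C(Set.Icc a b, F)) : Prop :=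
  ∀ (γ s M : ℝ) (y₁ y₂ : C(Set.Icc a b, F)), 0 ≤ γ → 0 < s → s ≤ γ + δ → ‖y₁‖ ≤ r → ‖y₂‖ ≤ r →
    (0 < γ → eqUpTo a b γ y₁ y₂) →
    (∀ t : Set.Icc a b, (t : ℝ) ≤ a + s → ‖y₁ t - y₂ t‖ ≤ M) →
    ∀ t : Set.Icc a b, (t : ℝ) ≤ a + s → ‖Ψ y₁ t - Ψ y₂ t‖ ≤ q * M

theorem IsLocallyContracting.exists_contractsOnSteps (hab : a ≤ b) {q : ℝ}
    {Ψ : C(Set.Icc a b, F) → C(Set.Icc a b, F)} (hVol : IsVolterra a b Ψ)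
    (hLC : IsLocallyContracting a b q Ψ) {r : ℝ} (hr : 0 < r) :
    ∃ δ > 0, ContractsOnSteps a b (max q 0) r δ Ψ := by
  obtain ⟨δ, hδ, H⟩ := hLC r hr
  refine ⟨δ, hδ, fun γ s M y₁ y₂ hγ hs hsγ h₁ h₂ heq hM t ht => ?_⟩
  have hM0 : 0 ≤ M := (norm_nonneg _).trans (hM ⟨a, le_rfl, hab⟩ (by simp [hs.le]))
  set z₁ := freezeAt hab s y₁
  set z₂ := freezeAt hab s y₂
  have hz : ∀ u, ‖(z₁ - z₂) u‖ ≤ M := fun u =>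
    hM _ ((coe_projIcc_min hab hs.le u).trans_le (min_le_right _ _))
  have hzeq : 0 < γ → eqUpTo a b γ z₁ z₂ := fun h => (heq h).freezeAt hab hs.le
  obtain ⟨H₁, H₂⟩ := H z₁ z₂
    ((partNorm_le_norm _ _).trans ((norm_freezeAt_le hab hs.le y₁).trans h₁))
    ((partNorm_le_norm _ _).trans ((norm_freezeAt_le hab hs.le y₂).trans h₂))
  have key : ∀ ξ, (t : ℝ) ≤ a + ξ →
      partNorm a b ξ (Ψ z₁ - Ψ z₂) ≤ q * partNorm a b ξ (z₁ - z₂) →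
      ‖Ψ y₁ t - Ψ y₂ t‖ ≤ max q 0 * M := by
    intro ξ hξ hle
    have e₁ : Ψ z₁ t = Ψ y₁ t := hVol.eqUpTo_map hs (eqUpTo_freezeAt hab s y₁) t ht
    have e₂ : Ψ z₂ t = Ψ y₂ t := hVol.eqUpTo_map hs (eqUpTo_freezeAt hab s y₂) t ht
    have hp : 0 ≤ partNorm a b ξ (z₁ - z₂) :=
      (norm_nonneg _).trans (norm_le_partNorm (z₁ - z₂) hξ)
    calc ‖Ψ y₁ t - Ψ y₂ t‖ = ‖(Ψ z₁ - Ψ z₂) t‖ := by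
          rw [ContinuousMap.sub_apply, e₁, e₂]
      _ ≤ partNorm a b ξ (Ψ z₁ - Ψ z₂) := norm_le_partNorm _ hξ
      _ ≤ q * partNorm a b ξ (z₁ - z₂) := hle
      _ ≤ max q 0 * partNorm a b ξ (z₁ - z₂) := by gcongr; exact le_max_left _ _
      _ ≤ max q 0 * M := by
          gcongr
          exact partNorm_le hM0 _ fun u _ => hz u
  rcases hγ.eq_or_lt with rfl | hγ'
  · exact key δ (by linarith) H₁
  rcases le_or_gt (b - a) δ with hbig | hsmall
  · exact key δ (by linarith [t.2.2]) H₁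
  rcases le_or_gt γ (b - a - δ) with hle | hgt
  · exact key (γ + δ) (by linarith) (H₂ γ ⟨hγ', hle⟩ (hzeq hγ'))
  · exact key (b - a - δ + δ) (by linarith [t.2.2])
      (H₂ _ ⟨by linarith, le_rfl⟩ ((hzeq hγ').mono hgt.le))

theorem eqUpTo_of_fixed (hab : a ≤ b) {q : ℝ} (hq : q < 1)
    {Ψ : C(Set.Icc a b, F) → C(Set.Icc a b, F)}
    (hΨ : ∀ r > 0, ∃ δ > 0, ContractsOnSteps a b q r δ Ψ) {s : ℝ} (hs : 0 < s)
    {y₁ y₂ : C(Set.Icc a b, F)} (h₁ : eqUpTo a b s (Ψ y₁) y₁) (h₂ : eqUpTo a b s (Ψ y₂) y₂) :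
    eqUpTo a b s y₁ y₂ := by
  obtain ⟨δ, hδ, H⟩ := hΨ (max ‖y₁‖ ‖y₂‖ + 1) (by positivity)
  have ind : ∀ n : ℕ, 0 < n → eqUpTo a b (min (n * δ) s) y₁ y₂ := by
    intro n
    induction n with
    | zero => intro h; exact absurd h (lt_irrefl _)
    | succ n ih =>
      intro _
      set σ := min (((n + 1 : ℕ) : ℝ) * δ) s with hσ
      have hσ0 : 0 < σ := lt_min (by positivity) hs
      set M := ‖freezeAt hab σ (y₁ - y₂)‖
      have hle : ∀ t : Set.Icc a b, (t : ℝ) ≤ a + σ → ‖y₁ t - y₂ t‖ ≤ M := by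
        intro t ht
        rw [← ContinuousMap.sub_apply, ← freezeAt_of_le hab (y₁ - y₂) ht]
        exact ContinuousMap.norm_coe_le_norm _ t
      have hc := H (min (n * δ) s) σ M y₁ y₂ (le_min (by positivity) hs.le) hσ0
        (by
          rw [hσ, ← min_add_add_right]
          push_cast
          exact min_le_min (by linarith) (by linarith))
        (by linarith [le_max_left ‖y₁‖ ‖y₂‖]) (by linarith [le_max_right ‖y₁‖ ‖y₂‖])
        (fun h => ih (Nat.pos_of_ne_zero fun h0 => by
          subst h0
          simp [hs.le] at h)) hle
      have hMnn : 0 ≤ M := norm_nonneg _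
      have hcon : ∀ t : Set.Icc a b, (t : ℝ) ≤ a + σ → ‖y₁ t - y₂ t‖ ≤ max q 0 * M := by
        intro t ht
        have hts : (t : ℝ) ≤ a + s :=
          ht.trans (by linarith [min_le_right (((n + 1 : ℕ) : ℝ) * δ) s])
        rw [← h₁ t hts, ← h₂ t hts]
        exact (hc t ht).trans (by gcongr; exact le_max_left _ _)
      have hMle : M ≤ max q 0 * M := norm_freezeAt_le_of_forall_le hab hσ0.le (by positivity) _ hcon
      have hM0 : M = 0 := by
        have : max q 0 < 1 := max_lt hq one_pos
        nlinarith
      intro t ht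
      have := hle t ht
      rw [hM0] at this
      exact sub_eq_zero.1 (norm_le_zero_iff.1 this)
  obtain ⟨n, hn⟩ := exists_nat_gt (s / δ)
  have hsn : s < n * δ := (div_lt_iff₀ hδ).1 hn
  have hn0 : 0 < n := Nat.pos_of_ne_zero fun h => by
    subst h
    simp at hsn
    linarith
  simpa [min_eq_right hsn.le] using ind n hn0

theorem isLocalSolution_iff (hab : a ≤ b) {Ψ : C(Set.Icc a b, F) → C(Set.Icc a b, F)}
    {γ : ℝ} {g : ℝ → F} :
    IsLocalSolution a b γ Ψ g ↔ 0 < γ ∧ γ ≤ b - a ∧ ∃ y : C(Set.Icc a b, F),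
      eqUpTo a b γ (Ψ y) y ∧ ∀ t : Set.Icc a b, (t : ℝ) ≤ a + γ → g t = y t := by
  constructor
  · rintro ⟨h0, hb, -, y, hy, hΨy⟩
    exact ⟨h0, hb, y, fun t ht => (hΨy t ht).trans (hy t ht).symm, fun t ht => (hy t ht).symm⟩
  · rintro ⟨h0, hb, y, hy, hg⟩
    refine ⟨h0, hb, ?_, y, fun t ht => (hg t ht).symm, fun t ht => (hy t ht).trans (hg t ht).symm⟩
    refine (y.continuous.comp continuous_projIcc).continuousOn.congr
      (f := fun t => y (Set.projIcc a b hab t)) fun t ht => ?_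
    have htb : t ∈ Set.Icc a b := ⟨ht.1, by linarith [ht.2]⟩
    simpa only [Set.projIcc_of_mem hab htb] using hg ⟨t, htb⟩ ht.2

/-- If local solutions are unique and not uniformly bounded, then they glue to a maximally
extended solution. -/
theorem exists_maxExt_of_unbounded (hab : a ≤ b)
    {Ψ : C(Set.Icc a b, F) → C(Set.Icc a b, F)}
    (huniq : ∀ (s : ℝ) (y₁ y₂ : C(Set.Icc a b, F)), 0 < s → eqUpTo a b s (Ψ y₁) y₁ →
      eqUpTo a b s (Ψ y₂) y₂ → eqUpTo a b s y₁ y₂)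
    (hunbdd : ∀ R > 0, ∃ (s : ℝ) (y : C(Set.Icc a b, F)), 0 < s ∧ s ≤ b - a ∧
      eqUpTo a b s (Ψ y) y ∧ ∃ t : Set.Icc a b, (t : ℝ) ≤ a + s ∧ R < ‖y t‖) :
    ∃ (ζ : ℝ) (g : ℝ → F), IsMaxExtSolution a b ζ Ψ g ∧
      ∀ (γ : ℝ) (g' : ℝ → F), IsLocalSolution a b γ Ψ g' →
        γ < ζ ∧ ∀ t ∈ Set.Icc a (a + γ), g' t = g t := by
  set S : Set ℝ := {s | 0 < s ∧ s ≤ b - a ∧ ∃ y, eqUpTo a b s (Ψ y) y}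
  have hSne : S.Nonempty := by
    obtain ⟨s, y, h0, hb, hy, -⟩ := hunbdd 1 one_pos
    exact ⟨s, h0, hb, y, hy⟩
  have hSbdd : BddAbove S := ⟨b - a, fun s hs => hs.2.1⟩
  set ζ := sSup S
  have hlt : ∀ s ∈ S, s < ζ := by
    rintro s ⟨h0, hb, y, hy⟩
    refine (le_csSup hSbdd ⟨h0, hb, y, hy⟩).lt_of_ne fun he => ?_
    obtain ⟨s', y', h0', hb', hy', t, ht, hR⟩ := hunbdd (‖y‖ + 1) (by positivity)
    have hs' : s' ≤ s := he ▸ le_csSup hSbdd ⟨h0', hb', y', hy'⟩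
    rw [huniq s' y' y h0' hy' (hy.mono hs') t ht] at hR
    linarith [y.norm_coe_le_norm t]
  have hmem : ∀ γ, 0 < γ → γ < ζ → γ ∈ S := by
    intro γ h0 hγ
    obtain ⟨s, ⟨-, hb, y, hy⟩, hs⟩ := exists_lt_of_lt_csSup hSne hγ
    exact ⟨h0, hs.le.trans hb, y, hy.mono hs.le⟩
  have hglue : ∀ t : ℝ, ∃ x : F, ∀ (s : ℝ) (y : C(Set.Icc a b, F)) (ht : t ∈ Set.Icc a b),
      0 < s → eqUpTo a b s (Ψ y) y → t ≤ a + s → y ⟨t, ht⟩ = x := by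
    intro t
    by_cases h : ∃ (s : ℝ) (y : C(Set.Icc a b, F)), 0 < s ∧ eqUpTo a b s (Ψ y) y ∧
        t ∈ Set.Icc a b ∧ t ≤ a + s
    · obtain ⟨s, y, h0, hy, ht, hts⟩ := h
      refine ⟨y ⟨t, ht⟩, fun s' y' _ h0' hy' hts' => ?_⟩
      exact huniq (min s s') y' y (lt_min h0 h0') (hy'.mono (min_le_right _ _))
        (hy.mono (min_le_left _ _)) ⟨t, ht⟩
        (by rw [← min_add_add_left]; exact le_min hts hts')
    · exact ⟨0, fun s y ht h0 hy hts => absurd ⟨s, y, h0, hy, ht, hts⟩ h⟩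
  choose g hg using hglue
  have hlocal : ∀ γ ∈ Set.Ioo (0 : ℝ) ζ, IsLocalSolution a b γ Ψ g := by
    intro γ hγ
    obtain ⟨h0, hb, y, hy⟩ := hmem γ hγ.1 hγ.2
    exact (isLocalSolution_iff hab).2
      ⟨h0, hb, y, hy, fun t ht => (hg t γ y t.2 h0 hy ht).symm⟩
  have hζ0 : 0 < ζ := by
    obtain ⟨s, hs⟩ := hSne
    exact hs.1.trans (hlt s hs)
  refine ⟨ζ, g, ⟨hζ0, csSup_le hSne fun s hs => hs.2.1, hlocal, ?_⟩, ?_⟩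
  · refine tendsto_atTop.2 fun R => ?_
    obtain ⟨s, y, h0, hb, hy, t, ht, hR⟩ := hunbdd (max R 1) (by positivity)
    filter_upwards [Ioo_mem_nhdsLT (hlt s ⟨h0, hb, y, hy⟩)] with γ hγ
    have hcont := (hlocal γ ⟨h0.trans hγ.1, hγ.2⟩).2.2.1
    have hmemt : (t : ℝ) ∈ Set.Icc a (a + γ) := ⟨t.2.1, by linarith [hγ.1]⟩
    refine le_trans ?_ (le_csSup (isCompact_Icc.bddAbove_image hcont.norm) ⟨t, hmemt, rfl⟩)
    show R ≤ ‖g t‖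
    rw [← hg t s y t.2 h0 hy ht]
    exact (le_max_left R 1).trans hR.le
  · intro γ g' hg'
    obtain ⟨h0, hb, y, hy, hgy⟩ := (isLocalSolution_iff hab).1 hg'
    refine ⟨hlt γ ⟨h0, hb, y, hy⟩, fun t ht => ?_⟩
    have htb : t ∈ Set.Icc a b := ⟨ht.1, by linarith [ht.2]⟩
    exact (hgy ⟨t, htb⟩ ht.2).trans (hg t γ y htb h0 hy ht.2)

variable [CompleteSpace F]

theorem ContractsOnSteps.exists_fixed (hab : a ≤ b) {q r δ : ℝ} (hq0 : 0 ≤ q) (hq : q < 1)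
    {Ψ : C(Set.Icc a b, F) → C(Set.Icc a b, F)} (hVol : IsVolterra a b Ψ)
    (hΨ : ContractsOnSteps a b q r δ Ψ) {γ s ρ : ℝ} (hγ : 0 ≤ γ) (hs : 0 < s) (hsγ : s ≤ γ + δ)
    (hρ : 0 ≤ ρ) {y₀ : C(Set.Icc a b, F)} (hr : ‖y₀‖ + ρ ≤ r) (hconst : freezeAt hab s y₀ = y₀)
    (hy₀ : 0 < γ → eqUpTo a b γ (Ψ y₀) y₀)
    (hdist : ∀ t : Set.Icc a b, (t : ℝ) ≤ a + s → ‖Ψ y₀ t - y₀ t‖ ≤ (1 - q) * ρ) :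
    ∃ y : C(Set.Icc a b, F), eqUpTo a b s (Ψ y) y := by
  set T : C(Set.Icc a b, F) → C(Set.Icc a b, F) := fun y => freezeAt hab s (Ψ y)
  set X : Set C(Set.Icc a b, F) :=
    {y | ‖y - y₀‖ ≤ ρ ∧ (0 < γ → eqUpTo a b γ y y₀)} with hX
  have hball : ∀ y ∈ X, ‖y‖ ≤ r := by
    intro y hy
    have : ‖y‖ ≤ ‖y₀‖ + ‖y - y₀‖ := by
      simpa using norm_add_le y₀ (y - y₀)
    linarith [hy.1]
  have hXclosed : IsClosed X := by
    have e : X = Metric.closedBall y₀ ρ ∩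
        {y | ∀ t : Set.Icc a b, 0 < γ → (t : ℝ) ≤ a + γ → y t = y₀ t} := by
      ext y
      simp only [hX, Set.mem_inter_iff, mem_closedBall_iff_norm, Set.mem_ofPred_eq, eqUpTo]
      tauto
    rw [e]
    refine Metric.isClosed_closedBall.inter ?_
    simp only [Set.ofPred_forall]
    refine isClosed_iInter fun t => isClosed_iInter fun _ => isClosed_iInter fun _ => ?_
    exact isClosed_eq (continuous_eval_const t) continuous_const
  have hmaps : Set.MapsTo T X X := by
    intro y hy
    refine ⟨?_, fun hγ' => ?_⟩
    · have e : T y - y₀ = freezeAt hab s (Ψ y - y₀) := by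
        conv_lhs => rw [← hconst]
        rfl
      rw [e]
      refine norm_freezeAt_le_of_forall_le hab hs.le hρ _ fun t ht => ?_
      have h1 := hΨ γ s ρ y y₀ hγ hs hsγ (hball y hy) (by linarith) hy.2
        (fun u _ => ((y - y₀).norm_coe_le_norm u).trans hy.1) t ht
      have h2 := hdist t ht
      have h3 : ‖Ψ y t - y₀ t‖ ≤ ‖Ψ y t - Ψ y₀ t‖ + ‖Ψ y₀ t - y₀ t‖ :=
        norm_sub_le_norm_sub_add_norm_sub _ _ _
      rw [ContinuousMap.sub_apply]
      linarith
    · have h := ((hVol.eqUpTo_map hγ' (hy.2 hγ')).trans (hy₀ hγ')).freezeAt hab hs.le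
      rwa [hconst] at h
  have hcontr : ContractingWith q.toNNReal (hmaps.restrict T X X) := by
    refine ⟨by simpa using hq, LipschitzWith.of_dist_le_mul fun y z => ?_⟩
    rw [Subtype.dist_eq, Subtype.dist_eq, dist_eq_norm, dist_eq_norm, Real.coe_toNNReal q hq0]
    refine norm_freezeAt_le_of_forall_le hab hs.le (by positivity) (Ψ y - Ψ z) fun t ht => ?_
    exact hΨ γ s _ y z hγ hs hsγ (hball y y.2) (hball z z.2)
      (fun h => (y.2.2 h).trans (z.2.2 h).symm)
      (fun u _ => ((y : C(Set.Icc a b, F)) - z).norm_coe_le_norm u) t ht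
  have hy₀X : y₀ ∈ X := ⟨by simpa using hρ, fun _ _ _ => rfl⟩
  obtain ⟨y, -, hfix, -⟩ := hcontr.exists_fixedPoint' hXclosed.isComplete hmaps hy₀X
    (edist_ne_top _ _)
  refine ⟨y, fun t ht => ?_⟩
  rw [← freezeAt_of_le hab (Ψ y) ht]
  exact DFunLike.congr_fun hfix t

theorem exists_fixed_upTo (hab : a < b) {q : ℝ} (hq0 : 0 ≤ q) (hq : q < 1)
    {Ψ : C(Set.Icc a b, F) → C(Set.Icc a b, F)} (hVol : IsVolterra a b Ψ)
    (hΨ : ∀ r > 0, ∃ δ > 0, ContractsOnSteps a b q r δ Ψ) :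
    ∃ s, 0 < s ∧ s ≤ b - a ∧ ∃ y : C(Set.Icc a b, F), eqUpTo a b s (Ψ y) y := by
  have hq1 : 0 < 1 - q := by linarith
  have hρ : 0 ≤ ‖Ψ 0‖ / (1 - q) := by positivity
  obtain ⟨δ, hδ, H⟩ := hΨ (‖Ψ 0‖ / (1 - q) + 1) (by positivity)
  have hs : 0 < min δ (b - a) := lt_min hδ (by linarith)
  refine ⟨min δ (b - a), hs, min_le_right _ _,
    H.exists_fixed hab.le hq0 hq hVol le_rfl hs (by simp) hρ (y₀ := 0) (by simp)
      (by ext; rfl) (fun h => absurd h (lt_irrefl _)) fun t _ => ?_⟩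
  rw [mul_div_cancel₀ _ hq1.ne', ContinuousMap.zero_apply, sub_zero]
  exact (Ψ 0).norm_coe_le_norm t

/-- If the local solutions are uniformly bounded, then there is a global solution. -/
theorem exists_global_of_bounded (hab : a < b) {q : ℝ} (hq0 : 0 ≤ q) (hq : q < 1)
    {Ψ : C(Set.Icc a b, F) → C(Set.Icc a b, F)} (hVol : IsVolterra a b Ψ)
    (hΨ : ∀ r > 0, ∃ δ > 0, ContractsOnSteps a b q r δ Ψ) {R : ℝ} (hR : 0 < R)
    (hbd : ∀ (s : ℝ) (y : C(Set.Icc a b, F)), 0 < s → s ≤ b - a → eqUpTo a b s (Ψ y) y →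
      ∀ t : Set.Icc a b, (t : ℝ) ≤ a + s → ‖y t‖ ≤ R) :
    ∃ y, Ψ y = y := by
  set S : Set ℝ := {s | 0 < s ∧ s ≤ b - a ∧ ∃ y, eqUpTo a b s (Ψ y) y}
  have hSne : S.Nonempty := exists_fixed_upTo hab hq0 hq hVol hΨ
  have hSbdd : BddAbove S := ⟨b - a, fun s hs => hs.2.1⟩
  have hconst : ∀ s ∈ S, ∃ y, ‖y‖ ≤ R ∧ eqUpTo a b s (Ψ y) y ∧
      ∀ σ, s ≤ σ → freezeAt hab.le σ y = y := by
    rintro s ⟨hs0, hsb, y, hy⟩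
    exact ⟨freezeAt hab.le s y,
      norm_freezeAt_le_of_forall_le hab.le hs0.le hR.le y (hbd s y hs0 hsb hy),
      hVol.eqUpTo_freezeAt_self hab.le hs0 hy, fun σ hσ => freezeAt_freezeAt hab.le hs0.le hσ y⟩
  obtain ⟨δ, hδ, H⟩ := hΨ R hR
  obtain ⟨γ₀, hγ₀, hγ₀'⟩ := exists_lt_of_lt_csSup hSne (by linarith : sSup S - δ < sSup S)
  obtain ⟨y₀, hy₀R, hy₀, -⟩ := hconst γ₀ hγ₀
  set K := q * (2 * R) + ‖Ψ y₀‖ + R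
  have hq1 : 0 < 1 - q := by linarith
  have hK0 : 0 ≤ K := by positivity
  obtain ⟨δ', hδ', H'⟩ := hΨ (R + K / (1 - q)) (by positivity)
  obtain ⟨γ, hγ, hγ₀γ, hγδ'⟩ : ∃ γ ∈ S, γ₀ ≤ γ ∧ sSup S - δ' < γ := by
    obtain ⟨γ₁, h₁, h₁'⟩ := exists_lt_of_lt_csSup hSne (by linarith : sSup S - δ' < sSup S)
    rcases le_total γ₀ γ₁ with h | h
    · exact ⟨γ₁, h₁, h, h₁'⟩
    · exact ⟨γ₀, hγ₀, le_rfl, by linarith⟩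
  obtain ⟨y, hyR, hy, hyconst⟩ := hconst γ hγ
  have hγle : γ ≤ sSup S := le_csSup hSbdd hγ
  set s := min (b - a) (min (γ₀ + δ) (γ + δ')) with hs
  have hs₁ : s ≤ b - a := min_le_left _ _
  have hs₂ : s ≤ γ₀ + δ := (min_le_right _ _).trans (min_le_left _ _)
  have hs₃ : s ≤ γ + δ' := (min_le_right _ _).trans (min_le_right _ _)
  have hγs : γ ≤ s := le_min hγ.2.1 (le_min (by linarith) (by linarith))
  have hs0 : 0 < s := hγ.1.trans_le hγs
  have hagree : eqUpTo a b γ₀ y y₀ :=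
    eqUpTo_of_fixed hab.le hq hΨ hγ₀.1 (hy.mono hγ₀γ) hy₀
  have hsS : s ∈ S := by
    refine ⟨hs0, hs₁, H'.exists_fixed hab.le hq0 hq hVol hγ.1.le hs0 hs₃ (ρ := K / (1 - q))
      (by positivity) (y₀ := y) (by linarith) (hyconst s hγs) (fun _ => hy) fun t ht => ?_⟩
    rw [mul_div_cancel₀ _ hq1.ne']
    have h1 := H γ₀ s (2 * R) y y₀ hγ₀.1.le hs0 hs₂ hyR hy₀R (fun _ => hagree)
      (fun u _ => (norm_sub_le _ _).trans
        (by linarith [y.norm_coe_le_norm u, y₀.norm_coe_le_norm u])) t ht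
    have h2 := (Ψ y₀).norm_coe_le_norm t
    have h3 := (y.norm_coe_le_norm t).trans hyR
    have h4 : ‖Ψ y t‖ ≤ ‖Ψ y₀ t‖ + ‖Ψ y t - Ψ y₀ t‖ := by
      simpa using norm_add_le (Ψ y₀ t) (Ψ y t - Ψ y₀ t)
    have h5 := norm_sub_le (Ψ y t) (y t)
    linarith
  have hsle : s ≤ sSup S := le_csSup hSbdd hsS
  have hsb : s = b - a := by
    refine hs₁.antisymm (le_of_not_gt fun hlt => ?_)
    have : sSup S < s := by
      rcases min_choice (b - a) (min (γ₀ + δ) (γ + δ')) with h | h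
      · exact absurd (hs.trans h) hlt.ne
      · rw [hs, h]
        exact lt_min (by linarith) (by linarith)
    linarith
  obtain ⟨-, -, z, hz⟩ := hsS
  exact ⟨z, hz.eq hsb.ge⟩

end

/-- Theorem 2.1 (existence part): a locally contracting Volterra operator has a unique global
or maximally extended solution, and each local solution is a restriction of this solution. -/
theorem exists_unique_global_or_maxExt_solution
    (a b q : ℝ) (hab : a < b) (hq : q < 1)
    (Ψ : C(Set.Icc a b, E) → C(Set.Icc a b, E))
    (hVol : IsVolterra a b Ψ) (hLC : IsLocallyContracting a b q Ψ) :
    Xor'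
      (∃ y : C(Set.Icc a b, E), Ψ y = y ∧
        ∀ (γ : ℝ) (g : ℝ → E), IsLocalSolution a b γ Ψ g →
          ∀ t : Set.Icc a b, (t : ℝ) ≤ a + γ → g t = y t)
      (∃ (ζ : ℝ) (g : ℝ → E), IsMaxExtSolution a b ζ Ψ g ∧
        ∀ (γ : ℝ) (g' : ℝ → E), IsLocalSolution a b γ Ψ g' →
          γ < ζ ∧ ∀ t ∈ Set.Icc a (a + γ), g' t = g t) := by
  have hq0 : 0 ≤ max q 0 := le_max_right _ _
  have hq1 : max q 0 < 1 := max_lt hq one_pos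
  have hΨ : ∀ r > 0, ∃ δ > 0, ContractsOnSteps a b (max q 0) r δ Ψ :=
    fun r hr => hLC.exists_contractsOnSteps hab.le hVol hr
  by_cases h : ∃ y, Ψ y = y
  · obtain ⟨y, hy⟩ := h
    refine Or.inl ⟨⟨y, hy, fun γ g hg t ht => ?_⟩, ?_⟩
    · obtain ⟨h0, -, z, hz, hgz⟩ := (isLocalSolution_iff hab.le).1 hg
      exact (hgz t ht).trans
        (eqUpTo_of_fixed hab.le hq1 hΨ h0 hz (fun u _ => by rw [hy]) t ht)
    · rintro ⟨ζ, g, ⟨-, hζ, -⟩, hmax⟩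
      have hsol : IsLocalSolution a b (b - a) Ψ fun t => y (Set.projIcc a b hab.le t) :=
        (isLocalSolution_iff hab.le).2 ⟨by linarith, le_rfl, y, fun u _ => by rw [hy],
          fun t _ => by rw [Set.projIcc_val]⟩
      exact absurd (hmax _ _ hsol).1 (not_lt.2 hζ)
  · refine Or.inr ⟨exists_maxExt_of_unbounded hab.le
      (fun s y₁ y₂ hs h₁ h₂ => eqUpTo_of_fixed hab.le hq1 hΨ hs h₁ h₂) fun R hR => ?_,
      fun ⟨y, hy, _⟩ => h ⟨y, hy⟩⟩
    by_contra! hcon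
    exact h (exists_global_of_bounded hab hq0 hq1 hVol hΨ hR hcon)
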